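/- arXiv:math/0406502 — 3 statements merged into one kernel-verified Lean document; each statement's English description precedes it below -/
import Mathlib

section
/- Let M be a module over the field F₂ = ℤ/2ℤ, let ∘ : M × M → M be F₂-bilinear, and suppose there exist F₂-trilinear maps E₁₂, E₂₁ : M × M × M → M such that a∘(b∘c) + (a∘b)∘c = E₁₂(a,b,c) + E₁₂(a,c,b) + E₂₁(a,b,c) + E₂₁(b,a,c) for all a, b, c ∈ M (the condition (cup1assoc) of an associative Hirsch algebra). Then the commutator [a,b] := a∘b + b∘a satisfies the Jacobi identity [[a,b],c] + [[b,c],a] + [[c,a],b] = 0 for all a, b, c ∈ M. -/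
/-- Over F₂ = ℤ/2ℤ, if a bilinear operation `op` satisfies the condition
(cup1assoc) of an associative Hirsch algebra, i.e.
`a∘(b∘c) + (a∘b)∘c = E₁₂(a,b,c) + E₁₂(a,c,b) + E₂₁(a,b,c) + E₂₁(b,a,c)`
for some trilinear maps `E₁₂`, `E₂₁`, then the commutator `[a,b] := a∘b + b∘a`
satisfies the Jacobi identity. -/
theorem hirsch_cup1assoc_implies_jacobi
    (M : Type*) [AddCommGroup M] [Module (ZMod 2) M]
    (op : M →ₗ[ZMod 2] M →ₗ[ZMod 2] M)
    (E12 : M →ₗ[ZMod 2] M →ₗ[ZMod 2] M →ₗ[ZMod 2] M)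
    (E21 : M →ₗ[ZMod 2] M →ₗ[ZMod 2] M →ₗ[ZMod 2] M)
    (h : ∀ a b c : M, op a (op b c) + op (op a b) c =
      E12 a b c + E12 a c b + E21 a b c + E21 b a c) :
    ∀ a b c : M,
      (op (op a b + op b a) c + op c (op a b + op b a)) +
      (op (op b c + op c b) a + op a (op b c + op c b)) +
      (op (op c a + op a c) b + op b (op c a + op a c)) = 0 := by
  intro a b c
  have add_self (x : M) : x + x = 0 := by
    rw [← two_smul (ZMod 2) x, show (2 : ZMod 2) = 0 from rfl, zero_smul]
  simp only [map_add, LinearMap.add_apply]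
  linear_combination (norm := abel) h a b c + h a c b + h b a c + h b c a + h c a b + h c b a +
    add_self (E12 a b c + E12 a c b + E12 b a c + E12 b c a + E12 c a b + E12 c b a +
      (E21 a b c + E21 a c b + E21 b a c + E21 b c a + E21 c a b + E21 c b a))
end

section
/- Let A be an associative algebra over the field F₂ = ℤ/2ℤ, let d : A → A be F₂-linear satisfying the Leibniz rule d(x·y) = d(x)·y + x·d(y), and let ⌣₁ : A × A → A be F₂-bilinear satisfying the left Hirsch formula (p·q) ⌣₁ r = p·(q ⌣₁ r) + (p ⌣₁ r)·q for all p, q, r ∈ A. Fix a, x, y ∈ A and suppose the Steenrod condition holds for the pairs (x, y) and (a, y), i.e. d(x ⌣₁ y) = d(x) ⌣₁ y + x ⌣₁ d(y) + x·y + y·x and d(a ⌣₁ y) = d(a) ⌣₁ y + a ⌣₁ d(y) + a·y + y·a. Then the Steenrod condition holds for the pair (a·x, y): d((a·x) ⌣₁ y) = d(a·x) ⌣₁ y + (a·x) ⌣₁ d(y) + (a·x)·y + y·(a·x). -/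
/-- Over F₂ = ℤ/2ℤ, suppose `d` satisfies the Leibniz rule and `⌣₁`
satisfies the left Hirsch formula. If the Steenrod condition holds for the pairs
`(x, y)` and `(a, y)`, then it holds for the pair `(a·x, y)`. This is the inductive
step in the proof that Adams's `⌣₁` on the cobar construction of a DG-bialgebra
satisfies the Steenrod condition. -/
theorem steenrod_inductive_step
    (A : Type*) [Ring A] [Algebra (ZMod 2) A]
    (d : A →ₗ[ZMod 2] A)
    (leibniz : ∀ x y : A, d (x * y) = d x * y + x * d y)
    (cup : A →ₗ[ZMod 2] A →ₗ[ZMod 2] A)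
    (lhirsch : ∀ p q r : A, cup (p * q) r = p * cup q r + cup p r * q)
    (a x y : A)
    (hxy : d (cup x y) = cup (d x) y + cup x (d y) + x * y + y * x)
    (hay : d (cup a y) = cup (d a) y + cup a (d y) + a * y + y * a) :
    d (cup (a * x) y) =
      cup (d (a * x)) y + cup (a * x) (d y) + (a * x) * y + y * (a * x) := by
  have h : a * y * x + a * y * x = 0 := by
    rw [← two_smul (ZMod 2), show (2 : ZMod 2) = 0 from rfl, zero_smul]
  rw [lhirsch, lhirsch, map_add, leibniz, leibniz, leibniz, hxy, hay, map_add,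
    LinearMap.add_apply, lhirsch, lhirsch, ← sub_eq_zero, ← h]
  noncomm_ring
end

section
/- Let A be an associative algebra over the field F₂ = ℤ/2ℤ, let d : A → A be F₂-linear satisfying the Leibniz rule d(x·y) = d(x)·y + x·d(y), let E₁ : A × A → A be F₂-bilinear and E₂ : A × A × A → A be F₂-trilinear. Assume for all a, a', y, y₁, y₂ ∈ A: (i) E₁(a·a', y) = a·E₁(a', y) + E₁(a, y)·a' (distributivity in the first argument, the case k = 1 of condition (E2n)); (ii) E₂(a·a', y₁, y₂) = a·E₂(a', y₁, y₂) + E₂(a, y₁, y₂)·a' + E₁(a, y₁)·E₁(a', y₂) (the case k = 2 of condition (E2n)); (iii) d(E₁(a, y)) + E₁(d(a), y) + E₁(a, d(y)) = a·y + y·a (Steenrod condition for E₁). For x ∈ A say that P(x) holds if for all y₁, y₂ ∈ A: d(E₂(x, y₁, y₂)) + E₂(d(x), y₁, y₂) + E₂(x, d(y₁), y₂) + E₂(x, y₁, d(y₂)) = y₁·E₁(x, y₂) + E₁(x, y₁)·y₂ + E₁(x, y₁·y₂) (the case k = 2 of the higher-homotopy condition (E1n)). If P(a) and P(a') hold, then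 P(a·a') holds. -/
/-- Over F₂ = ℤ/2ℤ, let `d` satisfy the Leibniz rule, `E₁` be bilinear
and `E₂` be trilinear, satisfying the distributivity conditions (E2n) for `k = 1, 2`
and the Steenrod condition for `E₁`. Let `P(x)` denote the case `k = 2` of the
higher-homotopy condition (E1n) for `x`. If `P(a)` and `P(a')` hold, then `P(a·a')`
holds. This is the inductive step in the paper's Proposition 3. -/
theorem hGa_E1n_inductive_step
    (A : Type*) [Ring A] [Algebra (ZMod 2) A]
    (d : A →ₗ[ZMod 2] A)
    (leibniz : ∀ x y : A, d (x * y) = d x * y + x * d y)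
    (E1 : A →ₗ[ZMod 2] A →ₗ[ZMod 2] A)
    (E2 : A →ₗ[ZMod 2] A →ₗ[ZMod 2] A →ₗ[ZMod 2] A)
    (distrib1 : ∀ a a' y : A, E1 (a * a') y = a * E1 a' y + E1 a y * a')
    (distrib2 : ∀ a a' y₁ y₂ : A,
      E2 (a * a') y₁ y₂ = a * E2 a' y₁ y₂ + E2 a y₁ y₂ * a' + E1 a y₁ * E1 a' y₂)
    (steenrodE1 : ∀ a y : A, d (E1 a y) + E1 (d a) y + E1 a (d y) = a * y + y * a)
    (a a' : A)
    (hPa : ∀ y₁ y₂ : A,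
      d (E2 a y₁ y₂) + E2 (d a) y₁ y₂ + E2 a (d y₁) y₂ + E2 a y₁ (d y₂) =
        y₁ * E1 a y₂ + E1 a y₁ * y₂ + E1 a (y₁ * y₂))
    (hPa' : ∀ y₁ y₂ : A,
      d (E2 a' y₁ y₂) + E2 (d a') y₁ y₂ + E2 a' (d y₁) y₂ + E2 a' y₁ (d y₂) =
        y₁ * E1 a' y₂ + E1 a' y₁ * y₂ + E1 a' (y₁ * y₂)) :
    ∀ y₁ y₂ : A,
      d (E2 (a * a') y₁ y₂) + E2 (d (a * a')) y₁ y₂ + E2 (a * a') (d y₁) y₂ +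
          E2 (a * a') y₁ (d y₂) =
        y₁ * E1 (a * a') y₂ + E1 (a * a') y₁ * y₂ + E1 (a * a') (y₁ * y₂) := by
  intro y₁ y₂
  have double (x : A) : (2 : ℤ) • x = 0 := by
    rw [two_zsmul, ← two_smul (ZMod 2) x, show (2 : ZMod 2) = 0 from rfl, zero_smul]
  have key : d (E2 (a * a') y₁ y₂) + E2 (d (a * a')) y₁ y₂ + E2 (a * a') (d y₁) y₂ +
      E2 (a * a') y₁ (d y₂) =
      a * (d (E2 a' y₁ y₂) + E2 (d a') y₁ y₂ + E2 a' (d y₁) y₂ + E2 a' y₁ (d y₂)) +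
      (d (E2 a y₁ y₂) + E2 (d a) y₁ y₂ + E2 a (d y₁) y₂ + E2 a y₁ (d y₂)) * a' +
      (d (E1 a y₁) + E1 (d a) y₁ + E1 a (d y₁)) * E1 a' y₂ +
      E1 a y₁ * (d (E1 a' y₂) + E1 (d a') y₂ + E1 a' (d y₂)) +
      (2 : ℤ) • (d a * E2 a' y₁ y₂ + E2 a y₁ y₂ * d a') := by
    simp only [leibniz, distrib2, map_add, LinearMap.add_apply, mul_add, add_mul]
    abel
  have regroup : a * (y₁ * E1 a' y₂ + E1 a' y₁ * y₂ + E1 a' (y₁ * y₂)) +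
      (y₁ * E1 a y₂ + E1 a y₁ * y₂ + E1 a (y₁ * y₂)) * a' +
      (a * y₁ + y₁ * a) * E1 a' y₂ + E1 a y₁ * (a' * y₂ + y₂ * a') =
      y₁ * E1 (a * a') y₂ + E1 (a * a') y₁ * y₂ + E1 (a * a') (y₁ * y₂) +
      (2 : ℤ) • (a * (y₁ * E1 a' y₂) + E1 a y₁ * (y₂ * a')) := by
    simp only [distrib1, mul_add, add_mul, mul_assoc]
    abel
  rw [key, hPa, hPa', steenrodE1, steenrodE1, double, add_zero, regroup, double, add_zero]
end
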